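/- arXiv:2105.07307 — 2 statements merged into one kernel-verified Lean document; each statement's English description precedes it below -/
import Mathlib

section
/- Let m = x_{i_1}⋯x_{i_s} be a square-free monomial in S = K[x_1,…,x_n] with i_1 < ⋯ < i_s ≤ n, with T(m) = (t_0,…,t_k), IT(m) = (i_{t_0},…,i_{t_k}), and ℓ the unique index with i_{t_{ℓ+1}} < t_0 ≤ i_{t_ℓ} (convention i_{t_{k+1}} = 0). Let I = sfBorel(m). Then ᾱ(I) ≤ (t_0 − t_ℓ + i_{t_ℓ})/(i_{t_k} − t_k + 1). -/
open MvPolynomial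

namespace SFB

/-- `B` is obtained from `A` by a single Borel move, where `A`, `B` are the
(1-based) supports of square-free monomials: some index `i ∈ A` is replaced
by an index `j` with `1 ≤ j < i` not already in `A`. -/
def BorelMove (A B : Finset ℕ) : Prop :=
  ∃ i ∈ A, ∃ j, 1 ≤ j ∧ j < i ∧ j ∉ A ∧ B = insert j (A.erase i)

/-- `B` is obtained from `A` by finitely many Borel moves (possibly none). -/
def BorelReach (A B : Finset ℕ) : Prop :=
  Relation.ReflTransGen BorelMove A B

/-- The square-free monomial `∏_{r ∈ A} x_r` in `K[x_1,…,x_n]`,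
where the variable `x_r` (for `1 ≤ r ≤ n`) is `X ⟨r-1,_⟩`. -/
noncomputable def sqfMon (K : Type*) [Field K] (n : ℕ) (A : Finset ℕ) :
    MvPolynomial (Fin n) K :=
  ∏ j : Fin n, if (j : ℕ) + 1 ∈ A then X j else 1

/-- The square-free principal Borel ideal generated by the square-free
monomial with (1-based) support `A`, inside `K[x_1,…,x_n]`. -/
noncomputable def sfBorel (K : Type*) [Field K] (n : ℕ) (A : Finset ℕ) :
    Ideal (MvPolynomial (Fin n) K) :=
  Ideal.span {f | ∃ B, BorelReach A B ∧ f = sqfMon K n B}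

/-- `α(J)`: the least degree of a nonzero homogeneous element of `J`. -/
noncomputable def alpha {K : Type*} [Field K] {n : ℕ}
    (J : Ideal (MvPolynomial (Fin n) K)) : ℕ :=
  sInf {d | ∃ f ∈ J, f ≠ 0 ∧ MvPolynomial.IsHomogeneous f d}

/-- The `s`-th symbolic power of `I`: the intersection of the `s`-th powers
of the minimal primes of `I`. -/
noncomputable def symbPow {R : Type*} [CommRing R] (I : Ideal R) (s : ℕ) :
    Ideal R :=
  ⨅ P ∈ I.minimalPrimes, P ^ s

/-- The Waldschmidt constant `ᾱ(I) = inf_{s ≥ 1} α(I^{(s)})/s`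
(which equals `lim_{s→∞} α(I^{(s)})/s`). -/
noncomputable def waldschmidt {K : Type*} [Field K] {n : ℕ}
    (I : Ideal (MvPolynomial (Fin n) K)) : ℝ :=
  ⨅ s : ℕ+, (alpha (symbPow I (s : ℕ)) : ℝ) / ((s : ℕ) : ℝ)

/-- `t 0, t 1, …, t k` is the sequence `T(m)` associated to the square-free
monomial `m = x_{i 1} ⋯ x_{i s}` (with `i` strictly increasing on `1,…,s`):
`t 0 = s`, and for `1 ≤ j ≤ k`, `t j = max { r < t (j-1) | i r < i (r+1) - 1 }`,
with `k` the last index for which this maximum exists. -/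
def IsTSeq (s : ℕ) (i : ℕ → ℕ) (t : ℕ → ℕ) (k : ℕ) : Prop :=
  t 0 = s ∧
  (∀ j, 1 ≤ j → j ≤ k →
    1 ≤ t j ∧ t j < t (j - 1) ∧ i (t j) + 1 < i (t j + 1) ∧
    ∀ r, t j < r → r < t (j - 1) → ¬ (i r + 1 < i (r + 1))) ∧
  (∀ r, 1 ≤ r → r < t k → ¬ (i r + 1 < i (r + 1)))

end SFB

namespace SFB

/-- Entrywise domination of strictly increasing sequences gives reachability. -/
lemma reach_of_le (s : ℕ) (i j : ℕ → ℕ)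
    (hi : ∀ a b, 1 ≤ a → a < b → b ≤ s → i a < i b)
    (hj : ∀ a b, 1 ≤ a → a < b → b ≤ s → j a < j b)
    (hj1 : ∀ a, 1 ≤ a → a ≤ s → 1 ≤ j a)
    (hle : ∀ a, 1 ≤ a → a ≤ s → j a ≤ i a) :
    BorelReach ((Finset.Icc 1 s).image i) ((Finset.Icc 1 s).image j) := by
  have key : ∀ p, p ≤ s → BorelReach ((Finset.Icc 1 s).image i)
      ((Finset.Icc 1 s).image (fun r => if r ≤ p then j r else i r)) := by
    intro p
    induction p with
    | zero =>
      intro _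
      have : (Finset.Icc 1 s).image (fun r => if r ≤ 0 then j r else i r)
          = (Finset.Icc 1 s).image i := by
        apply Finset.image_congr
        intro r hr
        have hr' := Finset.mem_Icc.1 (Finset.mem_coe.1 hr)
        have : ¬ r ≤ 0 := by omega
        simp only [this, if_false]
      rw [this]
      exact Relation.ReflTransGen.refl
    | succ p ih =>
      intro hp
      have ih' := ih (by omega)
      by_cases he : j (p + 1) = i (p + 1)
      · have : (Finset.Icc 1 s).image (fun r => if r ≤ p + 1 then j r else i r)
          = (Finset.Icc 1 s).image (fun r => if r ≤ p then j r else i r) := by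
          apply Finset.image_congr
          intro r hr
          by_cases h : r = p + 1
          · subst h; simp [he]
          · have : r ≤ p + 1 ↔ r ≤ p := by omega
            simp only [this]
        rw [this]; exact ih'
      · refine Relation.ReflTransGen.tail ih' ?_
        have hlt : j (p + 1) < i (p + 1) :=
          lt_of_le_of_ne (hle _ (by omega) hp) he
        have hneI : ∀ r, 1 ≤ r → r ≤ s → r ≠ p + 1 →
            (if r ≤ p then j r else i r) ≠ i (p + 1) := by
          intro r h1 h2 h3
          split_ifs with h
          · have := hj r (p + 1) h1 (by omega) hp
            omega
          · have := hi (p + 1) r (by omega) (by omega) h2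
            omega
        refine ⟨i (p + 1), ?_, j (p + 1), hj1 _ (by omega) hp, hlt, ?_, ?_⟩
        · exact Finset.mem_image.2 ⟨p + 1, Finset.mem_Icc.2 ⟨by omega, hp⟩, by simp⟩
        · intro hmem
          obtain ⟨r, hr, hr2⟩ := Finset.mem_image.1 hmem
          obtain ⟨h1, h2⟩ := Finset.mem_Icc.1 hr
          split_ifs at hr2 with h
          · have := hj r (p + 1) h1 (by omega) hp
            omega
          · by_cases h3 : r = p + 1
            · subst h3; omega
            · have := hi (p + 1) r (by omega) (by omega) h2
              omega
        · ext x
          simp only [Finset.mem_image, Finset.mem_insert, Finset.mem_erase, Finset.mem_Icc]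
          constructor
          · rintro ⟨r, ⟨h1, h2⟩, rfl⟩
            by_cases h : r = p + 1
            · left; subst h; simp
            · right
              have h' : r ≤ p + 1 ↔ r ≤ p := by omega
              simp only [h']
              exact ⟨hneI r h1 h2 h, r, ⟨h1, h2⟩, rfl⟩
          · rintro (rfl | ⟨hx, r, ⟨h1, h2⟩, rfl⟩)
            · exact ⟨p + 1, ⟨by omega, hp⟩, by simp⟩
            · have h : r ≠ p + 1 := by
                rintro rfl
                simp at hx
              have h' : r ≤ p + 1 ↔ r ≤ p := by omega
              exact ⟨r, ⟨h1, h2⟩, by simp only [h']⟩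
  have h := key s le_rfl
  have : (Finset.Icc 1 s).image (fun r => if r ≤ s then j r else i r)
      = (Finset.Icc 1 s).image j := by
    apply Finset.image_congr
    intro r hr
    have hr' := Finset.mem_Icc.1 (Finset.mem_coe.1 hr)
    simp only [hr'.2, if_true]
  rwa [this] at h

open Classical in
/-- A prime over `sfBorel` contains at least `i 1` of the first `s - 1 + i 1` variables. -/
lemma card_prime (K : Type*) [Field K] (n s N : ℕ) (i : ℕ → ℕ)
    (hi : ∀ a b, 1 ≤ a → a < b → b ≤ s → i a < i b)
    (hlow : ∀ a, 1 ≤ a → a ≤ s → i 1 + a ≤ i a + 1)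
    (hN : N + 1 = s + i 1) (hNn : N ≤ n)
    (P : Ideal (MvPolynomial (Fin n) K)) [P.IsPrime]
    (hP : sfBorel K n ((Finset.Icc 1 s).image i) ≤ P) :
    i 1 ≤ (Finset.univ.filter
      (fun x : Fin n => (x : ℕ) < N ∧ (X x : MvPolynomial (Fin n) K) ∈ P)).card := by
  by_contra hlt
  push Not at hlt
  set F := Finset.univ.filter
      (fun x : Fin n => (x : ℕ) < N ∧ (X x : MvPolynomial (Fin n) K) ∈ P) with hF
  let g : ℕ → Prop := fun x => ∃ y ∈ F, (y : ℕ) = x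
  let p : ℕ → Prop := fun x => ¬ g x
  have hg : ∀ y, Nat.count g y ≤ F.card := by
    intro y
    rw [Nat.count_eq_card_filter_range]
    refine le_trans (Finset.card_le_card (t := F.image (fun x : Fin n => (x : ℕ))) ?_)
      Finset.card_image_le
    intro x hx
    exact Finset.mem_image.2 (Finset.mem_filter.1 hx).2
  have hsum : ∀ y, Nat.count p y + Nat.count g y = y := by
    intro y
    induction y with
    | zero => simp
    | succ y ih =>
      rw [Nat.count_succ, Nat.count_succ]
      by_cases h : g y
      · have : ¬ p y := fun h' => h' h
        simp only [h, this, if_true, if_false]; omega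
      · have : p y := h
        simp only [h, this, if_true, if_false]; omega
  have hinf : (setOf p).Infinite := by
    apply Set.infinite_of_not_bddAbove
    rintro ⟨b, hb⟩
    have : b + n + 1 ∈ setOf p := by
      rintro ⟨y, _, hy⟩
      have := y.2
      omega
    have := hb this
    omega
  have hmem : ∀ a, p (Nat.nth p a) := fun a => Nat.nth_mem_of_infinite hinf a
  have hb : ∀ a, Nat.nth p a + 1 ≤ a + i 1 := by
    intro a
    have h1 := hsum (Nat.nth p a)
    rw [Nat.count_nth_of_infinite hinf] at h1
    have := hg (Nat.nth p a)
    omega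
  have hreach := reach_of_le s i (fun r => Nat.nth p (r - 1) + 1) hi
    (fun a b h1 h2 _ => by
      have := Nat.nth_strictMono hinf (show a - 1 < b - 1 by omega)
      omega)
    (fun a _ _ => by omega)
    (fun a h1 h2 => by
      have := hb (a - 1)
      have := hlow a h1 h2
      omega)
  have hm : sqfMon K n ((Finset.Icc 1 s).image (fun r => Nat.nth p (r - 1) + 1)) ∈ P :=
    hP (Ideal.subset_span ⟨_, hreach, rfl⟩)
  unfold sqfMon at hm
  rw [Ideal.IsPrime.prod_mem_iff] at hm
  obtain ⟨x, -, hx⟩ := hm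
  split_ifs at hx with h
  · obtain ⟨r, hr, hr2⟩ := Finset.mem_image.1 h
    obtain ⟨h1, h2⟩ := Finset.mem_Icc.1 hr
    have h3 := hb (r - 1)
    have h4 : Nat.nth p (r - 1) = x := by omega
    apply hmem (r - 1)
    refine ⟨x, ?_, h4.symm⟩
    rw [hF, Finset.mem_filter]
    exact ⟨Finset.mem_univ _, by omega, hx⟩
  · exact (Ideal.ne_top_iff_one P).1 (Ideal.IsPrime.ne_top inferInstance) hx

/-- The product of the first `N` variables lies in the symbolic power. -/
lemma alpha_le (K : Type*) [Field K] (n s N : ℕ) (i : ℕ → ℕ)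
    (hi : ∀ a b, 1 ≤ a → a < b → b ≤ s → i a < i b)
    (hlow : ∀ a, 1 ≤ a → a ≤ s → i 1 + a ≤ i a + 1)
    (hN : N + 1 = s + i 1) (hNn : N ≤ n) :
    alpha (symbPow (sfBorel K n ((Finset.Icc 1 s).image i)) (i 1)) ≤ N := by
  classical
  apply Nat.sInf_le
  set G := Finset.univ.filter (fun x : Fin n => (x : ℕ) < N) with hG
  have hcard : G.card = N := by
    have : G.image (fun x : Fin n => (x : ℕ)) = Finset.range N := by
      ext x
      simp only [hG, Finset.mem_image, Finset.mem_filter, Finset.mem_univ, true_and,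
        Finset.mem_range]
      constructor
      · rintro ⟨y, hy, rfl⟩; exact hy
      · intro hx; exact ⟨⟨x, by omega⟩, hx, rfl⟩
    rw [← Finset.card_image_of_injective G Fin.val_injective, this, Finset.card_range]
  refine ⟨∏ x ∈ G, X x, ?_, ?_, ?_⟩
  · unfold symbPow
    simp only [Ideal.mem_iInf]
    intro P hP
    have : P.IsPrime := hP.1.1
    have hc := card_prime K n s N i hi hlow hN hNn P hP.1.2
    rw [← Finset.prod_filter_mul_prod_filter_not G
      (fun x => (X x : MvPolynomial (Fin n) K) ∈ P)]
    apply Ideal.mul_mem_right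
    have hmem : ∏ x ∈ G with (X x : MvPolynomial (Fin n) K) ∈ P, (X x : MvPolynomial (Fin n) K)
        ∈ ∏ x ∈ G with (X x : MvPolynomial (Fin n) K) ∈ P, P :=
      Ideal.prod_mem_prod (fun x hx => (Finset.mem_filter.1 hx).2)
    rw [Finset.prod_const] at hmem
    refine Ideal.pow_le_pow_right ?_ hmem
    refine hc.trans (le_of_eq ?_)
    congr 1
    ext x
    simp [hG]
  · exact Finset.prod_ne_zero_iff.2 (fun x _ => X_ne_zero x)
  · have := MvPolynomial.IsHomogeneous.prod G (fun x => (X x : MvPolynomial (Fin n) K))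
      (fun _ => 1) (fun x _ => isHomogeneous_X K x)
    simpa [hcard] using this

end SFB

open SFB in
/-- Corollary 3.5: simplified upper bound for the Waldschmidt constant. -/
theorem statement5 (K : Type*) [Field K] (n s k ℓ : ℕ) (i t : ℕ → ℕ)
    (hs : 1 ≤ s)
    (hmono : ∀ r, 1 ≤ r → r < s → i r < i (r + 1))
    (h1 : 1 ≤ i 1) (hn : i s ≤ n)
    (hT : IsTSeq s i t k)
    (hℓk : ℓ ≤ k)
    (hℓ1 : t 0 ≤ i (t ℓ))
    (hℓ2 : ℓ < k → i (t (ℓ + 1)) < t 0) :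
    waldschmidt (sfBorel K n ((Finset.Icc 1 s).image i)) ≤
      ((t 0 : ℝ) - (t ℓ : ℝ) + (i (t ℓ) : ℝ)) / ((i (t k) : ℝ) - (t k : ℝ) + 1) := by
  obtain ⟨ht0, htj, htk⟩ := hT
  have hi : ∀ a b, 1 ≤ a → a < b → b ≤ s → i a < i b := by
    intro a b h1 h2
    induction b, h2 using Nat.le_induction with
    | base => intro h3; exact hmono a h1 (by omega)
    | succ b hb ih =>
      intro h3
      have hb' : a + 1 ≤ b := hb
      exact (ih (by omega)).trans (hmono b (by omega) (by omega))
  have hlow : ∀ a, 1 ≤ a → a ≤ s → i 1 + a ≤ i a + 1 := by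
    intro a h1
    induction a, h1 using Nat.le_induction with
    | base => intro _; omega
    | succ a ha ih =>
      intro h
      have := ih (by omega)
      have := hmono a ha (by omega)
      omega
  have ht : ∀ j, j ≤ k → 1 ≤ t j ∧ t j ≤ s := by
    intro j
    induction j with
    | zero => intro _; omega
    | succ j ih =>
      intro hj
      have := ih (by omega)
      obtain ⟨h1, h2, -⟩ := htj (j + 1) (by omega) hj
      simp only [Nat.add_sub_cancel] at h2
      omega
  have hk := ht k le_rfl
  have hblock : ∀ a, 1 ≤ a → a ≤ t k → i a + 1 = i 1 + a := by
    intro a h1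
    induction a, h1 using Nat.le_induction with
    | base => intro _; rfl
    | succ a ha ih =>
      intro h
      have := ih (by omega)
      have := hmono a ha (by omega)
      have := htk a ha (by omega)
      omega
  have hbk := hblock (t k) hk.1 le_rfl
  have hl := ht ℓ hℓk
  have hlowl := hlow (t ℓ) hl.1 hl.2
  have hlows := hlow s hs le_rfl
  have hα := alpha_le K n s (s + i 1 - 1) i hi hlow (by omega) (by omega)
  have hden : (i (t k) : ℝ) - (t k : ℝ) + 1 = (i 1 : ℝ) := by
    have : (i (t k) : ℝ) + 1 = (i 1 : ℝ) + (t k : ℝ) := by exact_mod_cast hbk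
    linarith
  rw [hden]
  have hpos : (0 : ℝ) < (i 1 : ℝ) := by exact_mod_cast h1
  unfold waldschmidt
  have hinf := ciInf_le (f := fun q : ℕ+ =>
    (alpha (symbPow (sfBorel K n ((Finset.Icc 1 s).image i)) (q : ℕ)) : ℝ) / ((q : ℕ) : ℝ))
    ⟨0, by rintro _ ⟨q, rfl⟩; positivity⟩ ⟨i 1, h1⟩
  refine hinf.trans ?_
  simp only [PNat.mk_coe]
  refine div_le_div_of_nonneg_right ?_ hpos.le
  have hfin : alpha (symbPow (sfBorel K n ((Finset.Icc 1 s).image i)) (i 1)) + t ℓ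
      ≤ t 0 + i (t ℓ) := by omega
  have : (alpha (symbPow (sfBorel K n ((Finset.Icc 1 s).image i)) (i 1)) : ℝ) + t ℓ
      ≤ t 0 + i (t ℓ) := by exact_mod_cast hfin
  linarith
end

section
/- For every rational number q ≥ 1 there exist a positive integer n and a square-free monomial m in S = K[x_1,…,x_n] such that ᾱ(sfBorel(m)) = q. Explicitly, if q = a/b with integers a ≥ b ≥ 1, one may take n = a and m = x_b x_{b+1}⋯x_a. -/
open MvPolynomial

namespace SFB

lemma reach_inv {A B : Finset ℕ} {n : ℕ} (hA : A ⊆ Finset.Icc 1 n) (h : BorelReach A B) :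
    B ⊆ Finset.Icc 1 n ∧ B.card = A.card := by
  induction h with
  | refl => exact ⟨hA, rfl⟩
  | tail _ hm ih =>
    obtain ⟨i, hi, j, hj1, hji, hj, rfl⟩ := hm
    obtain ⟨ih1, ih2⟩ := ih
    have hin := Finset.mem_Icc.1 (ih1 hi)
    refine ⟨?_, ?_⟩
    · intro x hx
      rcases Finset.mem_insert.1 hx with rfl | hx
      · exact Finset.mem_Icc.2 ⟨hj1, by omega⟩
      · exact ih1 (Finset.mem_of_mem_erase hx)
    · rw [Finset.card_insert_of_notMem (fun h => hj (Finset.mem_of_mem_erase h)),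
        Finset.card_erase_of_mem hi, ← ih2]
      have := Finset.card_pos.2 ⟨i, hi⟩
      omega

lemma reach_all (a b : ℕ) (k : ℕ) : ∀ B : Finset ℕ, B ⊆ Finset.Icc 1 a →
    B.card = (Finset.Icc b a).card → (Finset.Icc b a \ B).card = k →
    BorelReach (Finset.Icc b a) B := by
  induction k with
  | zero =>
    intro B _ hc hk
    have hsub : Finset.Icc b a ⊆ B := by
      rw [Finset.card_eq_zero] at hk
      exact Finset.sdiff_eq_empty_iff_subset.1 hk
    have := Finset.eq_of_subset_of_card_le hsub hc.le
    rw [← this]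
    exact Relation.ReflTransGen.refl
  | succ k ih =>
    intro B hB hc hk
    obtain ⟨i, hi⟩ : (Finset.Icc b a \ B).Nonempty := Finset.card_pos.1 (by omega)
    obtain ⟨hiA, hiB⟩ := Finset.mem_sdiff.1 hi
    have hk2 : (B \ Finset.Icc b a).card = k + 1 := by
      rw [← hk]; exact Finset.card_sdiff_comm hc
    obtain ⟨j, hj⟩ : (B \ Finset.Icc b a).Nonempty := Finset.card_pos.1 (by omega)
    obtain ⟨hjB, hjA⟩ := Finset.mem_sdiff.1 hj
    have hj1 := Finset.mem_Icc.1 (hB hjB)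
    have hi1 := Finset.mem_Icc.1 hiA
    have hjb : j < b := by
      by_contra h
      exact hjA (Finset.mem_Icc.2 ⟨by omega, hj1.2⟩)
    have hij : i ≠ j := by omega
    have key : BorelReach (Finset.Icc b a) (insert i (B.erase j)) := by
      apply ih
      · intro x hx
        rcases Finset.mem_insert.1 hx with rfl | hx
        · exact Finset.mem_Icc.2 ⟨by omega, hi1.2⟩
        · exact hB (Finset.mem_of_mem_erase hx)
      · rw [Finset.card_insert_of_notMem (fun h => hiB (Finset.mem_of_mem_erase h)),
          Finset.card_erase_of_mem hjB, ← hc]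
        have := Finset.card_pos.2 ⟨j, hjB⟩
        omega
      · have : Finset.Icc b a \ insert i (B.erase j) = (Finset.Icc b a \ B).erase i := by
          ext x
          simp only [Finset.mem_sdiff, Finset.mem_insert, Finset.mem_erase]
          constructor
          · rintro ⟨h1, h2⟩
            refine ⟨fun h => h2 (Or.inl h), h1, fun h => h2 (Or.inr ⟨?_, h⟩)⟩
            rintro rfl
            exact hjA h1
          · rintro ⟨h1, h2, h3⟩
            exact ⟨h2, fun h => h.elim h1 (fun h => h3 h.2)⟩
        rw [this, Finset.card_erase_of_mem hi]
        omega
    refine Relation.ReflTransGen.tail key ⟨i, by simp, j, hj1.1, by omega, ?_, ?_⟩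
    · simp [hij.symm]
    · ext x
      simp only [Finset.mem_insert, Finset.mem_erase]
      constructor
      · intro hx
        by_cases hxj : x = j
        · exact Or.inl hxj
        · refine Or.inr ⟨?_, Or.inr ⟨hxj, hx⟩⟩
          rintro rfl
          exact hiB hx
      · rintro (rfl | ⟨h1, h2 | h2⟩)
        · exact hjB
        · exact absurd h2 h1
        · exact h2.2

/-- The prime generated by the variables in `T`. -/
noncomputable def PT (K : Type*) [Field K] {n : ℕ} (T : Finset (Fin n)) :
    Ideal (MvPolynomial (Fin n) K) := Ideal.span (X '' (T : Set (Fin n)))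

lemma PT_prime (K : Type*) [Field K] {n : ℕ} (T : Finset (Fin n)) : (PT K T).IsPrime := by
  classical
  let φ : MvPolynomial (Fin n) K →ₐ[K] MvPolynomial (Fin n) K :=
    aeval (fun i => if i ∈ T then 0 else X i)
  have h : PT K T = RingHom.ker φ := by
    apply le_antisymm
    · refine Ideal.span_le.2 ?_
      rintro _ ⟨i, hi, rfl⟩
      have hi' : i ∈ T := hi
      simp [φ, RingHom.mem_ker, hi']
    · intro f hf
      have hs : ∀ f : MvPolynomial (Fin n) K, f - φ f ∈ PT K T := by
        intro f
        induction f using MvPolynomial.induction_on with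
        | C c => simp [φ]
        | add p q hp hq =>
          have := Ideal.add_mem _ hp hq
          rw [map_add]
          convert this using 1
          ring
        | mul_X p i hp =>
          have hx : (X i : MvPolynomial (Fin n) K) - φ (X i) ∈ PT K T := by
            by_cases hi : i ∈ T
            · have hmem : (X i : MvPolynomial (Fin n) K) ∈ PT K T :=
                Ideal.subset_span ⟨i, hi, rfl⟩
              simpa [φ, hi] using hmem
            · simp [φ, hi]
          have := Ideal.add_mem _ (Ideal.mul_mem_right (X i) _ hp)
            (Ideal.mul_mem_left _ (φ p) hx)
          rw [map_mul]
          convert this using 1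
          ring
      have := hs f
      rwa [RingHom.mem_ker.1 hf, sub_zero] at this
  rw [h]
  exact RingHom.ker_isPrime _

lemma PT_pow {K : Type*} [Field K] {n : ℕ} (T : Finset (Fin n)) (s : ℕ) :
    ∀ f ∈ PT K T ^ s, ∀ u ∈ f.support, s ≤ ∑ i ∈ T, u i := by
  classical
  induction s with
  | zero => intros; exact Nat.zero_le _
  | succ s ih =>
    intro f hf
    rw [pow_succ] at hf
    refine Submodule.mul_induction_on hf ?_ ?_
    · intro g hg h hh u hu
      obtain ⟨v, hv, w, hw, rfl⟩ := Finset.mem_add.1 (support_mul g h hu)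
      have h1 := ih g hg v hv
      obtain ⟨i, hi, hwi⟩ := mem_ideal_span_X_image.1 hh w hw
      have h2 : w i ≤ ∑ i ∈ T, w i :=
        Finset.single_le_sum (f := fun i => w i) (fun _ _ => Nat.zero_le _) hi
      simp only [Finsupp.add_apply, Finset.sum_add_distrib]
      omega
    · intro x y hx hy u hu
      rcases Finset.mem_union.1 (support_add hu) with h | h
      · exact hx u h
      · exact hy u h

/-- A prime containing the ideal contains at least `b` variables. -/
lemma prime_vars {K : Type*} [Field K] {a b : ℕ} (hb : 1 ≤ b) (hba : b ≤ a)
    (Q : Ideal (MvPolynomial (Fin a) K)) (hQ : Q.IsPrime)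
    (hI : sfBorel K a (Finset.Icc b a) ≤ Q) :
    ∃ V : Finset (Fin a), V.card = b ∧ ∀ i ∈ V, (X i : MvPolynomial (Fin a) K) ∈ Q := by
  classical
  let W : Finset (Fin a) := Finset.univ.filter (fun i => (X i : MvPolynomial (Fin a) K) ∈ Q)
  have hW : b ≤ W.card := by
    by_contra hlt
    have hc : a + 1 - b ≤ Wᶜ.card := by
      rw [Finset.card_compl, Fintype.card_fin]; omega
    obtain ⟨U, hU, hUc⟩ := Finset.exists_subset_card_eq hc
    have hinj : Function.Injective (fun i : Fin a => (i : ℕ) + 1) := by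
      intro x y h
      exact Fin.ext (by simpa using h)
    have hmem : sqfMon K a (U.image (fun i : Fin a => (i : ℕ) + 1)) ∈ Q := by
      apply hI
      apply Ideal.subset_span
      refine ⟨_, reach_all a b _ _ ?_ ?_ rfl, rfl⟩
      · intro x hx
        obtain ⟨i, _, rfl⟩ := Finset.mem_image.1 hx
        exact Finset.mem_Icc.2 ⟨by omega, by have := i.2; omega⟩
      · rw [Finset.card_image_of_injective _ hinj, hUc, Nat.card_Icc]
    unfold sqfMon at hmem
    obtain ⟨j, _, hj⟩ := (Ideal.IsPrime.prod_mem_iff).1 hmem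
    split_ifs at hj with h
    · obtain ⟨i, hi, hij⟩ := Finset.mem_image.1 h
      have : i = j := hinj hij
      subst this
      have := hU hi
      simp [W] at this
      exact this hj
    · exact hQ.ne_top ((Ideal.eq_top_iff_one _).2 hj)
  obtain ⟨V, hV, hVc⟩ := Finset.exists_subset_card_eq hW
  exact ⟨V, hVc, fun i hi => (Finset.mem_filter.1 (hV hi)).2⟩

lemma le_PT {K : Type*} [Field K] {a b : ℕ} (hb : 1 ≤ b) (hba : b ≤ a)
    (T : Finset (Fin a)) (hT : T.card = b) : sfBorel K a (Finset.Icc b a) ≤ PT K T := by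
  classical
  refine Ideal.span_le.2 ?_
  rintro _ ⟨B, hB, rfl⟩
  obtain ⟨h1, h2⟩ := reach_inv (n := a) (Finset.Icc_subset_Icc_left hb) hB
  have hinj : Function.Injective (fun i : Fin a => (i : ℕ) + 1) := by
    intro x y h
    exact Fin.ext (by simpa using h)
  obtain ⟨j, hjT, hj⟩ : ∃ j ∈ T, (j : ℕ) + 1 ∈ B := by
    by_contra! hno
    have hd : Disjoint B (T.image (fun i : Fin a => (i : ℕ) + 1)) := by
      rw [Finset.disjoint_right]
      intro x hx
      obtain ⟨i, hi, rfl⟩ := Finset.mem_image.1 hx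
      exact hno i hi
    have hsub : B ∪ T.image (fun i : Fin a => (i : ℕ) + 1) ⊆ Finset.Icc 1 a := by
      refine Finset.union_subset h1 ?_
      intro x hx
      obtain ⟨i, _, rfl⟩ := Finset.mem_image.1 hx
      exact Finset.mem_Icc.2 ⟨by omega, by have := i.2; omega⟩
    have := Finset.card_le_card hsub
    rw [Finset.card_union_of_disjoint hd, Finset.card_image_of_injective _ hinj, h2, hT,
      Nat.card_Icc, Nat.card_Icc] at this
    omega
  refine Ideal.mem_of_dvd _ (Finset.dvd_prod_of_mem _ (Finset.mem_univ j)) ?_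
  rw [if_pos hj]
  exact Ideal.subset_span ⟨j, hjT, rfl⟩

lemma PT_min {K : Type*} [Field K] {a b : ℕ} (hb : 1 ≤ b) (hba : b ≤ a)
    (T : Finset (Fin a)) (hT : T.card = b) :
    PT K T ∈ (sfBorel K a (Finset.Icc b a)).minimalPrimes := by
  refine ⟨⟨PT_prime K T, le_PT hb hba T hT⟩, ?_⟩
  rintro Q ⟨hQ, hIQ⟩ hQT
  obtain ⟨V, hV, hVQ⟩ := prime_vars hb hba Q hQ hIQ
  have hVT : V ⊆ T := by
    intro i hi
    obtain ⟨j, hj, hji⟩ := mem_ideal_span_X_image.1 (hQT (hVQ i hi)) (Finsupp.single i 1)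
      (by simp [X])
    have : i = j := by
      by_contra h
      exact hji (by simp [Finsupp.single_apply, h])
    exact this ▸ hj
  have hVT' : V = T := Finset.eq_of_subset_of_card_le hVT (by omega)
  refine Ideal.span_le.2 ?_
  rintro _ ⟨i, hi, rfl⟩
  exact hVQ i (hVT' ▸ hi)

lemma prod_mem {K : Type*} [Field K] {a b : ℕ} (hb : 1 ≤ b) (hba : b ≤ a) :
    (∏ i : Fin a, (X i : MvPolynomial (Fin a) K)) ∈
      symbPow (sfBorel K a (Finset.Icc b a)) b := by
  simp only [symbPow, Ideal.mem_iInf]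
  rintro P ⟨⟨hP, hIP⟩, _⟩
  obtain ⟨V, hV, hVP⟩ := prime_vars hb hba P hP hIP
  refine Ideal.mem_of_dvd _ (Finset.prod_dvd_prod_of_subset V _ _ (Finset.subset_univ _)) ?_
  have := Ideal.prod_mem_prod (I := fun _ => P) hVP
  rwa [Finset.prod_const, hV] at this

lemma symb_nonempty {K : Type*} [Field K] {a b : ℕ} (hb : 1 ≤ b) (hba : b ≤ a) (s : ℕ) :
    {d | ∃ f ∈ symbPow (sfBorel K a (Finset.Icc b a)) s, f ≠ 0 ∧
      MvPolynomial.IsHomogeneous f d}.Nonempty := by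
  have h0 := prod_mem (K := K) hb hba
  have hh : (∏ i : Fin a, (X i : MvPolynomial (Fin a) K)).IsHomogeneous (∑ _i : Fin a, 1) :=
    IsHomogeneous.prod _ _ _ (fun i _ => isHomogeneous_X K i)
  refine ⟨_, (∏ i : Fin a, (X i : MvPolynomial (Fin a) K)) ^ s, ?_, ?_, hh.pow s⟩
  · simp only [symbPow, Ideal.mem_iInf] at h0 ⊢
    intro P hP
    exact Ideal.pow_mem_pow (Ideal.pow_le_self (by omega) (h0 P hP)) s
  · exact pow_ne_zero _ (Finset.prod_ne_zero_iff.2 fun i _ => X_ne_zero i)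

lemma alpha_le_s8 {K : Type*} [Field K] {a b : ℕ} (hb : 1 ≤ b) (hba : b ≤ a) :
    alpha (symbPow (sfBorel K a (Finset.Icc b a)) b) ≤ a := by
  refine Nat.sInf_le ⟨_, prod_mem hb hba, Finset.prod_ne_zero_iff.2 fun i _ => X_ne_zero i, ?_⟩
  have hh : (∏ i : Fin a, (X i : MvPolynomial (Fin a) K)).IsHomogeneous (∑ _i : Fin a, 1) :=
    IsHomogeneous.prod _ _ _ (fun i _ => isHomogeneous_X K i)
  simpa using hh

lemma le_alpha {K : Type*} [Field K] {a b : ℕ} (hb : 1 ≤ b) (hba : b ≤ a) (s : ℕ) :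
    a * s ≤ b * alpha (symbPow (sfBorel K a (Finset.Icc b a)) s) := by
  classical
  obtain ⟨f, hf, hf0, hfh⟩ := Nat.sInf_mem (symb_nonempty (K := K) hb hba s)
  change f.IsHomogeneous (alpha (symbPow (sfBorel K a (Finset.Icc b a)) s)) at hfh
  generalize alpha (symbPow (sfBorel K a (Finset.Icc b a)) s) = e at hfh
  obtain ⟨u, hu⟩ := MvPolynomial.ne_zero_iff.1 hf0
  have hsum : ∑ i, u i = e := by
    have := hfh hu
    rw [← this, Finsupp.weight_apply, Finsupp.sum_fintype] <;> simp
  have hlow : ∀ T : Finset (Fin a), T.card = b → s ≤ ∑ i ∈ T, u i := by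
    intro T hT
    simp only [symbPow, Ideal.mem_iInf] at hf
    exact PT_pow T s f (hf _ (PT_min hb hba T hT)) u (mem_support_iff.2 hu)
  obtain ⟨T, -, hT⟩ := Finset.exists_subset_card_eq (s := (Finset.univ : Finset (Fin a)))
    (n := b) (by simpa using hba)
  haveI : NeZero a := ⟨by omega⟩
  calc a * s = ∑ _g : Fin a, s := by simp
    _ ≤ ∑ g : Fin a, ∑ i ∈ T, u (i + g) := by
        refine Finset.sum_le_sum fun g _ => ?_
        have := hlow (T.map (Equiv.addRight g).toEmbedding) (by simpa using hT)
        simpa [Finset.sum_map] using this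
    _ = ∑ i ∈ T, ∑ g : Fin a, u (i + g) := Finset.sum_comm
    _ = ∑ i ∈ T, e := by
        refine Finset.sum_congr rfl fun i _ => ?_
        rw [← hsum]
        exact Equiv.sum_comp (Equiv.addLeft i) (fun x => u x)
    _ = b * e := by simp [hT]

lemma main {K : Type*} [Field K] {a b : ℕ} (hb : 1 ≤ b) (hba : b ≤ a) :
    waldschmidt (sfBorel K a (Finset.Icc b a)) = (a : ℝ) / (b : ℝ) := by
  have hb0 : (0 : ℝ) < b := by exact_mod_cast hb
  apply le_antisymm
  · have hbdd : BddBelow (Set.range fun s : ℕ+ =>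
        (alpha (symbPow (sfBorel K a (Finset.Icc b a)) (s : ℕ)) : ℝ) / ((s : ℕ) : ℝ)) :=
      ⟨0, by rintro _ ⟨s, rfl⟩; positivity⟩
    refine (ciInf_le hbdd ⟨b, hb⟩).trans ?_
    have := alpha_le_s8 (K := K) hb hba
    simp only [PNat.mk_coe]
    gcongr
  · refine le_ciInf fun s => ?_
    have hs : (0 : ℝ) < ((s : ℕ) : ℝ) := by exact_mod_cast s.pos
    rw [div_le_div_iff₀ hb0 hs, mul_comm _ (b : ℝ)]
    exact_mod_cast le_alpha (K := K) hb hba s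

end SFB

open SFB in
/-- Corollary 4.3: every rational `q ≥ 1` is the Waldschmidt constant of a
square-free principal Borel ideal; explicitly, for integers `a ≥ b ≥ 1` one
may take `n = a` and `m = x_b x_{b+1} ⋯ x_a`. -/
theorem statement8 (K : Type*) [Field K] :
    (∀ q : ℚ, 1 ≤ q → ∃ (n : ℕ) (A : Finset ℕ), A.Nonempty ∧
      (∀ a ∈ A, 1 ≤ a ∧ a ≤ n) ∧
      waldschmidt (sfBorel K n A) = (q : ℝ)) ∧
    (∀ a b : ℕ, 1 ≤ b → b ≤ a →
      waldschmidt (sfBorel K a (Finset.Icc b a)) = (a : ℝ) / (b : ℝ)) := by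
  refine ⟨fun q hq => ?_, fun a b hb hba => SFB.main hb hba⟩
  have hden : 1 ≤ q.den := q.pos
  have hnum : (q.den : ℤ) ≤ q.num := by
    have h := hq
    rw [← Rat.num_div_den q, le_div_iff₀ (by exact_mod_cast q.pos), one_mul] at h
    exact_mod_cast h
  have hcast : ((q.num.toNat : ℕ) : ℤ) = q.num := Int.toNat_of_nonneg (by omega)
  have hle : q.den ≤ q.num.toNat := by omega
  refine ⟨q.num.toNat, Finset.Icc q.den q.num.toNat, Finset.nonempty_Icc.2 hle, ?_, ?_⟩
  · intro x hx
    have := Finset.mem_Icc.1 hx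
    exact ⟨by omega, this.2⟩
  · rw [SFB.main hden hle, Rat.cast_def]
    congr 1
    exact_mod_cast congrArg (fun z : ℤ => (z : ℝ)) hcast
end
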